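/- If v ∈ H = H₁ ⊗ ⋯ ⊗ Hₙ is a hyperentangled unit vector, then for every i ∈ {1,…,n} the Hilbert dimension of H_i equals the Hilbert dimension of H_{{i}'} = ⊗_{j≠i} H_j. -/

import Mathlib

open scoped InnerProductSpace

noncomputable section

/-- The (completed) Hilbert tensor product `H = H₁ ⊗ ⋯ ⊗ Hₙ` of a finite family of complex
Hilbert spaces `Hs i`, presented as a Hilbert space `H` together with a multilinear map
`tmul` (elementary tensors) whose inner products multiply, whose elementary tensors span a
dense subspace, and together with, for each factor `i`, the embedding
`A ↦ A ⊗ (identity on the other factors)` of the bounded operators on `Hs i`. -/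
structure MultiTensor (ι : Type*) [Fintype ι] [DecidableEq ι] (Hs : ι → Type*) (H : Type*)
    [∀ i, NormedAddCommGroup (Hs i)] [∀ i, InnerProductSpace ℂ (Hs i)]
    [∀ i, CompleteSpace (Hs i)]
    [NormedAddCommGroup H] [InnerProductSpace ℂ H] [CompleteSpace H] where
  tmul : MultilinearMap ℂ Hs H
  inner_tmul : ∀ x y, ⟪tmul x, tmul y⟫_ℂ = ∏ i, ⟪x i, y i⟫_ℂ
  dense_span : Dense (↑(Submodule.span ℂ (Set.range tmul)) : Set H)
  embed : ∀ i, (Hs i →L[ℂ] Hs i) → (H →L[ℂ] H)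
  embed_tmul : ∀ i A x, embed i A (tmul x) = tmul (Function.update x i (A (x i)))

variable {ι : Type*} [Fintype ι] [DecidableEq ι] {Hs : ι → Type*} {H : Type*}
    [∀ i, NormedAddCommGroup (Hs i)] [∀ i, InnerProductSpace ℂ (Hs i)]
    [∀ i, CompleteSpace (Hs i)]
    [NormedAddCommGroup H] [InnerProductSpace ℂ H] [CompleteSpace H]

/-- The von Neumann algebra of the subsystem `S`: the double commutant (in the bounded
operators on `H`) of the operators of the form `A ⊗ I` with `A` a bounded operator on a
factor `Hs i`, `i ∈ S`.  (It consists of the operators `B ⊗ I` with `B` bounded on `H_S`.) -/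
def MultiTensor.alg (T : MultiTensor ι Hs H) (S : Set ι) : Set (H →L[ℂ] H) :=
  Set.centralizer (Set.centralizer (⋃ i ∈ S, Set.range (T.embed i)))

/-- An orthogonal projection on a Hilbert space: a self-adjoint idempotent bounded operator. -/
def IsONProj {E : Type*} [NormedAddCommGroup E] [InnerProductSpace ℂ E] [CompleteSpace E]
    (P : E →L[ℂ] E) : Prop :=
  IsSelfAdjoint P ∧ P ∘L P = P

/-- The algebra of the subsystem `S` is maximally correlated with the algebra of the
subsystem `S'` in the state `v`: for every nonzero orthogonal projection `P'` of the algebra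
of `S` and every `ε > 0` there is a nonzero orthogonal projection `P` of the algebra of `S'`
with `⟪v, P v⟫ > 0` and `⟪v, P' P v⟫ ≥ (1 - ε) ⟪v, P v⟫`. -/
def MultiTensor.MaxCorr (T : MultiTensor ι Hs H) (S S' : Set ι) (v : H) : Prop :=
  ∀ P' ∈ T.alg S, IsONProj P' → P' ≠ 0 → ∀ ε : ℝ, 0 < ε →
    ∃ P ∈ T.alg S', IsONProj P ∧ P ≠ 0 ∧
      0 < (⟪v, P v⟫_ℂ).re ∧
      (1 - ε) * (⟪v, P v⟫_ℂ).re ≤ (⟪v, P' (P v)⟫_ℂ).re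

/-- `v` is hyperentangled: for all disjoint nonempty subsystems `S`, `S'` of `{1,…,n}`, the
algebra of `S` is maximally correlated with the algebra of `S'` in `v`. -/
def MultiTensor.Hyper (T : MultiTensor ι Hs H) (v : H) : Prop :=
  ∀ S S' : Set ι, S.Nonempty → S'.Nonempty → Disjoint S S' → T.MaxCorr S S' v


universe u

/-- An orthonormal family in a separable space is countable. -/
lemma Orthonormal.countable_of_separableSpace {E κ : Type*} [NormedAddCommGroup E]
    [InnerProductSpace ℂ E] [TopologicalSpace.SeparableSpace E] {w : κ → E}
    (hw : Orthonormal ℂ w) : Countable κ := by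
  refine Pairwise.countable_of_isOpen_disjoint (s := fun k => Metric.ball (w k) (1 / 2))
    (fun k l hkl => Metric.ball_disjoint_ball ?_) (fun _ => Metric.isOpen_ball)
    (fun k => ⟨w k, Metric.mem_ball_self (by norm_num)⟩)
  have h : ‖w k - w l‖ * ‖w k - w l‖ = 2 := by
    rw [norm_sub_mul_self (𝕜 := ℂ), hw.2 hkl, hw.1, hw.1]
    norm_num
  rw [dist_eq_norm]
  nlinarith [norm_nonneg (w k - w l)]

namespace MultiTensor

section Basis

variable (T : MultiTensor ι Hs H) {J : ι → Type*} (b : ∀ j, HilbertBasis (J j) ℂ (Hs j))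

/-- The elementary tensor of basis vectors. -/
def basisTensor (q : ∀ j, J j) : H := T.tmul fun j => b j (q j)

open Classical in
lemma inner_basisTensor (q r : ∀ j, J j) :
    ⟪T.basisTensor b q, T.basisTensor b r⟫_ℂ = if q = r then 1 else 0 := by
  simp only [basisTensor, T.inner_tmul, orthonormal_iff_ite.1 (b _).orthonormal]
  split_ifs with h
  · simp [h]
  · obtain ⟨j, hj⟩ := Function.ne_iff.1 h
    exact Finset.prod_eq_zero (Finset.mem_univ j) (by simp [hj])

lemma norm_tmul (x : ∀ j, Hs j) : ‖T.tmul x‖ = ∏ j, ‖x j‖ := by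
  have h := T.inner_tmul x x
  simp only [inner_self_eq_norm_sq_to_K, Finset.prod_pow] at h
  norm_cast at h
  exact (pow_left_inj₀ (norm_nonneg _) (Finset.prod_nonneg fun _ _ => norm_nonneg _)
    two_ne_zero).1 h

lemma inner_tmul_eq_zero {w : H} (hw : ∀ q, ⟪T.basisTensor b q, w⟫_ℂ = 0)
    (x : ∀ j, Hs j) : ⟪T.tmul x, w⟫_ℂ = 0 := by
  suffices h : ∀ s : Finset ι, ∀ x : ∀ j, Hs j, (∀ j ∉ s, x j ∈ Set.range (b j)) →
      ⟪T.tmul x, w⟫_ℂ = 0 from h Finset.univ x (by simp)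
  intro s
  induction s using Finset.induction_on with
  | empty =>
    intro x hx
    choose q hq using fun j => hx j (Finset.notMem_empty j)
    rw [← hw q, basisTensor, funext hq]
  | insert i s hi ih =>
    intro x hx
    let f : Hs i →L[ℂ] H := (T.tmul.toLinearMap x i).mkContinuous
      (∏ j ∈ Finset.univ.erase i, ‖x j‖) fun a => by
        rw [MultilinearMap.toLinearMap_apply, norm_tmul,
          ← Finset.mul_prod_erase _ _ (Finset.mem_univ i), mul_comm]
        simp only [Function.update_self]
        refine le_of_eq (congrArg (· * _) (Finset.prod_congr rfl fun j hj => ?_))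
        rw [Function.update_of_ne (Finset.ne_of_mem_erase hj)]
    have hf : f.adjoint w = 0 := by
      refine (Submodule.dense_iff_topologicalClosure_eq_top.2
        (b i).dense_span).eq_zero_of_inner_right (𝕜 := ℂ) fun a ha => ?_
      induction ha using Submodule.span_induction with
      | mem a ha =>
        rw [ContinuousLinearMap.adjoint_inner_right]
        refine ih _ fun j hj => ?_
        rcases eq_or_ne j i with rfl | hji
        · simpa using ha
        · simpa [hji] using hx j (by simp [hji, hj])
      | zero => simp
      | add a c _ _ ha hc => rw [inner_add_left, ha, hc, add_zero]
      | smul c a _ ha => rw [inner_smul_left, ha, mul_zero]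
    have := f.adjoint_inner_right (x i) w
    rw [hf, inner_zero_right] at this
    simpa [f] using this.symm

lemma eq_zero_of_inner_basisTensor {w : H} (hw : ∀ q, ⟪T.basisTensor b q, w⟫_ℂ = 0) :
    w = 0 :=
  T.dense_span.eq_zero_of_inner_right (𝕜 := ℂ) fun u hu => by
    induction hu using Submodule.span_induction with
    | mem u hu =>
      obtain ⟨x, rfl⟩ := hu
      exact T.inner_tmul_eq_zero b hw x
    | zero => simp
    | add a c _ _ ha hc => rw [inner_add_left, ha, hc, add_zero]
    | smul c a _ ha => rw [inner_smul_left, ha, mul_zero]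

lemma dense_span_basisTensor :
    Dense (↑(Submodule.span ℂ (Set.range (T.basisTensor b))) : Set H) := by
  rw [Submodule.dense_iff_topologicalClosure_eq_top, Submodule.topologicalClosure_eq_top_iff,
    Submodule.eq_bot_iff]
  intro w hw
  rw [Submodule.mem_orthogonal] at hw
  exact T.eq_zero_of_inner_basisTensor b fun q => hw _ (Submodule.subset_span ⟨q, rfl⟩)

lemma ext_basisTensor {A B : H →L[ℂ] H}
    (h : ∀ q, A (T.basisTensor b q) = B (T.basisTensor b q)) : A = B :=
  ContinuousLinearMap.ext_on (T.dense_span_basisTensor b) (by rintro _ ⟨q, rfl⟩; exact h q)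

end Basis

section Algebra

variable (T : MultiTensor ι Hs H)

lemma embed_mem_alg {S : Set ι} {i : ι} (hi : i ∈ S) (A : Hs i →L[ℂ] Hs i) :
    T.embed i A ∈ T.alg S :=
  Set.subset_centralizer_centralizer (Set.mem_biUnion hi ⟨A, rfl⟩)

/-- The algebra of a subsystem, as a subalgebra of the bounded operators. -/
def subalg (S : Set ι) : Subalgebra ℂ (H →L[ℂ] H) :=
  Subalgebra.centralizer ℂ (Set.centralizer (⋃ i ∈ S, Set.range (T.embed i)))

lemma exists_mem_alg_tmul_piecewise {S : Set ι} (A : ∀ j, Hs j →L[ℂ] Hs j) (s : Finset ι)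
    (hs : ∀ j ∈ s, j ∈ S) :
    ∃ K ∈ T.subalg S, ∀ x, K (T.tmul x) = T.tmul (s.piecewise (fun j => A j (x j)) x) := by
  induction s using Finset.induction_on with
  | empty => exact ⟨1, one_mem _, fun x => by simp⟩
  | insert i s hi ih =>
    obtain ⟨K, hK, hKx⟩ := ih fun j hj => hs j (Finset.mem_insert_of_mem hj)
    refine ⟨T.embed i (A i) * K, mul_mem
      (T.embed_mem_alg (hs i (Finset.mem_insert_self i s)) (A i)) hK, fun x => ?_⟩
    rw [mul_apply_eq_comp, hKx, T.embed_tmul, Finset.piecewise_insert]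
    simp [hi]

variable {J : ι → Type*} (b : ∀ j, HilbertBasis (J j) ℂ (Hs j)) (p : ι → Prop)
  [DecidablePred p]

/-- The elementary tensor of basis vectors with indices split along a subsystem. -/
def splitTensor (x : ∀ j : {j // p j}, J j) (y : ∀ j : {j // ¬p j}, J j) : H :=
  T.basisTensor b ((Equiv.piEquivPiSubtypeProd p J).symm (x, y))

open Classical in
lemma inner_splitTensor (x x' : ∀ j : {j // p j}, J j) (y y' : ∀ j : {j // ¬p j}, J j) :
    ⟪T.splitTensor b p x y, T.splitTensor b p x' y'⟫_ℂ =
      (if x = x' then 1 else 0) * (if y = y' then 1 else 0) := by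
  rw [splitTensor, splitTensor, inner_basisTensor, ite_mul, one_mul, zero_mul, ← ite_and]
  simp [Prod.ext_iff]

lemma forall_basisTensor {Q : H → Prop} (h : ∀ x y, Q (T.splitTensor b p x y))
    (q : ∀ j, J j) : Q (T.basisTensor b q) := by
  have := h (Equiv.piEquivPiSubtypeProd p J q).1 (Equiv.piEquivPiSubtypeProd p J q).2
  rwa [splitTensor, Prod.mk.eta, Equiv.symm_apply_apply] at this

open Classical in
lemma exists_matrixUnit (x x' : ∀ j : {j // p j}, J j) :
    ∃ K ∈ T.subalg {j | p j}, ∀ x'' y, K (T.splitTensor b p x'' y) =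
      if x' = x'' then T.splitTensor b p x y else 0 := by
  obtain ⟨K, hK, hKx⟩ := T.exists_mem_alg_tmul_piecewise (S := {j | p j})
    (fun j => if h : p j then InnerProductSpace.rankOne ℂ (b j (x ⟨j, h⟩)) (b j (x' ⟨j, h⟩))
      else 0) (Finset.univ.filter p) (by simp)
  refine ⟨K, hK, fun x'' y => ?_⟩
  rw [splitTensor, basisTensor, hKx]
  split_ifs with h
  · subst h
    rw [splitTensor, basisTensor]
    congr 1
    ext1 j
    by_cases hj : p j
    · simp [Finset.piecewise, hj, (b j).orthonormal.1]
    · simp [Finset.piecewise, hj]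
  · obtain ⟨⟨j, hj⟩, hne⟩ := Function.ne_iff.1 h
    refine T.tmul.map_coord_zero j ?_
    simp [Finset.piecewise, hj, orthonormal_iff_ite.1 (b _).orthonormal, hne]

/-- If the first tensor factor has larger dimension than the second one, which is finite, then
no vector is separating for the algebra of the first factor. -/
lemma exists_proj_apply_eq_zero (b : ∀ j, HilbertBasis (J j) ℂ (Hs j))
    [Finite (∀ j : {j // ¬p j}, J j)]
    [Nonempty (∀ j : {j // ¬p j}, J j)]
    (hlt : Cardinal.mk (∀ j : {j // ¬p j}, J j) < Cardinal.mk (∀ j : {j // p j}, J j)) (v : H) :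
    ∃ P ∈ T.alg {j | p j}, IsONProj P ∧ P ≠ 0 ∧ P v = 0 := by
  classical
  have := Fintype.ofFinite (∀ j : {j // ¬p j}, J j)
  have hdep : ¬LinearIndependent ℂ
      (fun x : ∀ j : {j // p j}, J j => fun y => ⟪v, T.splitTensor b p x y⟫_ℂ) := by
    intro h
    have hle := h.cardinal_lift_le_rank
    rw [rank_fun', ← Cardinal.mk_fintype, Cardinal.lift_le] at hle
    exact hlt.not_ge hle
  rw [linearIndependent_iff] at hdep
  push Not at hdep
  obtain ⟨c, hc, hc0⟩ := hdep
  let w : (∀ j : {j // ¬p j}, J j) → H := fun y => ∑ x ∈ c.support, c x • T.splitTensor b p x y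
  have hvw : ∀ y, ⟪v, w y⟫_ℂ = 0 := fun y => by
    have := congrFun hc y
    rw [Finsupp.linearCombination_apply, Finsupp.sum, Finset.sum_apply] at this
    simpa [w, inner_sum, inner_smul_right] using this
  have hew : ∀ x y y', ⟪T.splitTensor b p x y, w y'⟫_ℂ = if y = y' then c x else 0 := by
    intro x y y'
    simp only [w, inner_sum, inner_smul_right, inner_splitTensor]
    split_ifs with h <;> simp +contextual
  choose K hK hKe using T.exists_matrixUnit b p
  let N : ℝ := ∑ x ∈ c.support, ‖c x‖ ^ 2
  have hN : 0 < N := Finset.sum_pos (fun x hx => by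
    have := norm_pos_iff.2 (Finsupp.mem_support_iff.1 hx)
    positivity) (Finsupp.support_nonempty_iff.2 hc0)
  let P : H →L[ℂ] H := (N : ℂ)⁻¹ • ∑ x ∈ c.support, ∑ x' ∈ c.support,
    (c x * starRingEnd ℂ (c x')) • K x x'
  have hPe : ∀ x y, P (T.splitTensor b p x y) =
      ((N : ℂ)⁻¹ * starRingEnd ℂ (c x)) • w y := by
    intro x y
    simp only [P, w, smul_apply, sum_apply, hKe,
      Finset.smul_sum, smul_smul]
    refine Finset.sum_congr rfl fun x' _ => ?_
    by_cases hx : c x = 0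
    · rw [hx, Finset.sum_eq_zero]
      · simp
      · intro x'' hx''
        rw [if_neg, smul_zero]
        rintro rfl
        exact Finsupp.mem_support_iff.1 hx'' hx
    · rw [Finset.sum_eq_single x]
      · rw [if_pos rfl]
        congr 1
        ring
      · intro x'' _ hne
        simp [hne]
      · simp [hx]
  have hPw : ∀ y, P (w y) = w y := by
    intro y
    simp only [w, map_sum, map_smul, hPe, smul_smul, ← Finset.sum_smul]
    have : ∑ x ∈ c.support, c x * ((N : ℂ)⁻¹ * starRingEnd ℂ (c x)) = 1 := by
      have hN' : (N : ℂ) ≠ 0 := by exact_mod_cast hN.ne'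
      rw [← inv_mul_cancel₀ hN']
      simp only [N, Complex.ofReal_sum, Finset.mul_sum]
      refine Finset.sum_congr rfl fun x _ => ?_
      rw [mul_left_comm, RCLike.mul_conj]
      push_cast
      rfl
    rw [this, one_smul]
  have hadj : P.adjoint = P := by
    refine T.ext_basisTensor b (T.forall_basisTensor b p (Q := fun u => P.adjoint u = P u) fun x y => ?_)
    rw [← sub_eq_zero]
    refine T.eq_zero_of_inner_basisTensor b (T.forall_basisTensor b p
      (Q := fun u => ⟪u, _⟫_ℂ = 0) fun x' y' => ?_)
    rw [inner_sub_right, P.adjoint_inner_right, hPe, hPe, inner_smul_left, inner_smul_right, hew,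
      ← inner_conj_symm, hew]
    by_cases h : y = y'
    · subst h
      simp
      ring
    · simp [h, Ne.symm h]
  refine ⟨P, ?_, ⟨hadj, ?_⟩, ?_, ?_⟩
  · exact (T.subalg _).smul_mem (sum_mem fun x _ => sum_mem fun x' _ =>
      (T.subalg _).smul_mem (hK x x') _) _
  · refine T.ext_basisTensor b (T.forall_basisTensor b p (Q := fun u => (P ∘L P) u = P u) fun x y => ?_)
    rw [ContinuousLinearMap.comp_apply, hPe, map_smul, hPw]
  · rintro h0
    obtain ⟨x, hx⟩ := Finsupp.support_nonempty_iff.2 hc0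
    obtain ⟨y⟩ := ‹Nonempty (∀ j : {j // ¬p j}, J j)›
    have h := hew x y y
    rw [← hPw y, h0, zero_apply, inner_zero_right, if_pos rfl] at h
    exact Finsupp.mem_support_iff.1 hx h.symm
  · refine T.eq_zero_of_inner_basisTensor b (T.forall_basisTensor b p
      (Q := fun u => ⟪u, _⟫_ℂ = 0) fun x y => ?_)
    rw [← hadj, P.adjoint_inner_right, hPe, inner_smul_left, ← inner_conj_symm, hvw]
    simp

end Algebra

lemma MaxCorr.apply_ne_zero {T : MultiTensor ι Hs H} {S S' : Set ι} {v : H}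
    (h : T.MaxCorr S S' v) {P : H →L[ℂ] H} (hP : P ∈ T.alg S) (hproj : IsONProj P)
    (h0 : P ≠ 0) : P v ≠ 0 := by
  intro hPv
  obtain ⟨Q, -, -, -, hpos, hle⟩ := h P hP hproj h0 (1 / 2) (by norm_num)
  rw [← P.adjoint_inner_left, ← ContinuousLinearMap.star_eq_adjoint,
    hproj.1.star_eq, hPv, inner_zero_left, Complex.zero_re] at hle
  linarith

lemma Hyper.mk_le_mk_compl [∀ i, TopologicalSpace.SeparableSpace (Hs i)]
    {T : MultiTensor ι Hs H} {v : H} (hv : T.Hyper v) {J : ι → Type*} [∀ j, Nonempty (J j)]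
    (b : ∀ j, HilbertBasis (J j) ℂ (Hs j)) (p : ι → Prop) [DecidablePred p]
    (hp : ∃ j, p j) (hp' : ∃ j, ¬p j) :
    Cardinal.mk (∀ j : {j // p j}, J j) ≤ Cardinal.mk (∀ j : {j // ¬p j}, J j) := by
  have hJ : ∀ j, Countable (J j) := fun j => (b j).orthonormal.countable_of_separableSpace
  rcases finite_or_infinite (∀ j : {j // ¬p j}, J j) with hfin | hinf
  · by_contra! hlt
    obtain ⟨P, hP, hproj, h0, hPv⟩ := T.exists_proj_apply_eq_zero p b hlt v
    exact (hv {j | p j} {j | ¬p j} hp hp' (Set.disjoint_left.2 fun _ h h' => h' h)).apply_ne_zero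
      hP hproj h0 hPv
  · exact Cardinal.mk_le_aleph0.trans (Cardinal.aleph0_le_mk _)

end MultiTensor

/-- if `v ∈ H = H₁ ⊗ ⋯ ⊗ Hₙ` is a hyperentangled unit vector, then for every
`i` the Hilbert dimension of `H_i` equals the Hilbert dimension of `H_{i'} = ⊗_{j ≠ i} H_j`
(the Hilbert dimension of a tensor product being the product of the Hilbert dimensions of
its factors, i.e. the cardinality of a product of orthonormal bases). -/
theorem hyper_imp_dim_factor_eq_dim_complement
    [∀ i, TopologicalSpace.SeparableSpace (Hs i)]
    (hn : 1 < Fintype.card ι) (hdim : ∀ i, 1 < Module.rank ℂ (Hs i))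
    (T : MultiTensor ι Hs H) (v : H) (hv : ‖v‖ = 1) (hhy : T.Hyper v) :
    ∀ (i : ι) (J : ι → Type u) (b : ∀ j, HilbertBasis (J j) ℂ (Hs j)),
      Cardinal.mk (J i) = ∏ j ∈ Finset.univ.erase i, Cardinal.mk (J j) := by
  intro i J b
  have hne : ∀ j, Nonempty (J j) := fun j => by
    by_contra hempty
    rw [not_nonempty_iff] at hempty
    have hsub : Subsingleton (Hs j) := (b j).repr.toEquiv.subsingleton
    have := hdim j
    rw [rank_subsingleton'] at this
    exact absurd this (by simp)
  obtain ⟨k, hk⟩ := Fintype.exists_ne_of_one_lt_card hn i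
  have hle := hhy.mk_le_mk_compl b (· = i) ⟨i, rfl⟩ ⟨k, hk⟩
  have hge := hhy.mk_le_mk_compl b (· ≠ i) ⟨k, hk⟩ ⟨i, by simp⟩
  simp only [Cardinal.mk_pi, Cardinal.prod_eq_of_fintype, Cardinal.lift_le] at hle hge
  have hprod : ∀ (s : Finset ι) (q : ι → Prop) [Fintype {j // q j}], (∀ j, j ∈ s ↔ q j) →
      ∏ j : {j // q j}, Cardinal.mk (J j) = ∏ j ∈ s, Cardinal.mk (J j) := fun s q _ h =>
    (Finset.prod_subtype s h fun j => Cardinal.mk (J j)).symm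
  rw [hprod {i} (· = i) (by simp), hprod (Finset.univ.erase i) (¬· = i) (by simp)] at hle
  rw [hprod (Finset.univ.erase i) (· ≠ i) (by simp), hprod {i} (¬· ≠ i) (by simp)] at hge
  simpa using le_antisymm hle hge

end
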